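/- Suppose the equation x' = −x² + q(t)x + p(t) has at least one globally defined bounded solution, and that the globally defined solutions a and r are uniformly separated, i.e., inf_{t∈ℝ}(a(t) − r(t)) > 0. Then a is an attractive hyperbolic solution and r is a repulsive hyperbolic solution. -/

import Mathlib

open Set Filter

/-- The right-hand side of the quadratic equation `x' = -x² + Q(t)x + P(t)`. -/
def quadF (Q P : ℝ → ℝ) : ℝ → ℝ → ℝ := fun t x => -x ^ 2 + Q t * x + P t

/-- `b` is a globally defined bounded solution of `x' = -x² + Q(t)x + P(t)`. -/
def IsBddSol (Q P b : ℝ → ℝ) : Prop :=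
  (∀ t, HasDerivAt b (quadF Q P t (b t)) t) ∧ ∃ C, ∀ t, |b t| ≤ C

/-- `(k, β)` is a dichotomy constant pair witnessing that the variational equation
`z' = (-2 b(t) + Q(t)) z` is Hurwitz at `+∞` (attractive case). -/
def AttrDich (Q b : ℝ → ℝ) (k β : ℝ) : Prop :=
  1 ≤ k ∧ 0 < β ∧ ∀ s t : ℝ, s ≤ t →
    Real.exp (∫ l in s..t, (-2 * b l + Q l)) ≤ k * Real.exp (-β * (t - s))

/-- `(k, β)` is a dichotomy constant pair witnessing that the variational equation
`z' = (-2 b(t) + Q(t)) z` is Hurwitz at `−∞` (repulsive case). -/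
def RepDich (Q b : ℝ → ℝ) (k β : ℝ) : Prop :=
  1 ≤ k ∧ 0 < β ∧ ∀ s t : ℝ, t ≤ s →
    Real.exp (∫ l in s..t, (-2 * b l + Q l)) ≤ k * Real.exp (β * (t - s))

/-- `b` is an attractive hyperbolic solution of `x' = -x² + Q(t)x + P(t)`. -/
def IsAttrHyp (Q P b : ℝ → ℝ) : Prop := IsBddSol Q P b ∧ ∃ k β : ℝ, AttrDich Q b k β

/-- `b` is a repulsive hyperbolic solution of `x' = -x² + Q(t)x + P(t)`. -/
def IsRepHyp (Q P b : ℝ → ℝ) : Prop := IsBddSol Q P b ∧ ∃ k β : ℝ, RepDich Q b k β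

/-- `b` is a hyperbolic solution of `x' = -x² + Q(t)x + P(t)`. -/
def IsHyp (Q P b : ℝ → ℝ) : Prop := IsAttrHyp Q P b ∨ IsRepHyp Q P b

/-- The supremum norm distance between `f` and `g` is `< δ`. -/
def SupLt (f g : ℝ → ℝ) (δ : ℝ) : Prop := ∃ d : ℝ, d < δ ∧ ∀ t, |f t - g t| ≤ d

/-- The family of maximal solutions `t ↦ X t s x₀` of the scalar ODE `x' = h (t, x)`. -/
structure MaxSolFamily (h : ℝ → ℝ → ℝ) where
  X : ℝ → ℝ → ℝ → ℝ
  dom : ℝ → ℝ → Set ℝ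
  dom_open : ∀ s x₀, IsOpen (dom s x₀)
  dom_ordConn : ∀ s x₀, (dom s x₀).OrdConnected
  mem_dom : ∀ s x₀, s ∈ dom s x₀
  init : ∀ s x₀, X s s x₀ = x₀
  sol : ∀ s x₀, ∀ t ∈ dom s x₀, HasDerivAt (fun τ => X τ s x₀) (h t (X t s x₀)) t
  maximal : ∀ s x₀ (y : ℝ → ℝ) (I : Set ℝ), IsOpen I → I.OrdConnected → s ∈ I →
      y s = x₀ → (∀ t ∈ I, HasDerivAt y (h t (y t)) t) →
      I ⊆ dom s x₀ ∧ ∀ t ∈ I, y t = X t s x₀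

/-- The solution `X · s x₀` is (defined and) bounded as `t → −∞`. -/
def BddAtBot {h : ℝ → ℝ → ℝ} (F : MaxSolFamily h) (s x₀ : ℝ) : Prop :=
  ∃ C : ℝ, ∀ᶠ t in atBot, t ∈ F.dom s x₀ ∧ |F.X t s x₀| ≤ C

/-- The solution `X · s x₀` is (defined and) bounded as `t → ∞`. -/
def BddAtTop {h : ℝ → ℝ → ℝ} (F : MaxSolFamily h) (s x₀ : ℝ) : Prop :=
  ∃ C : ℝ, ∀ᶠ t in atTop, t ∈ F.dom s x₀ ∧ |F.X t s x₀| ≤ C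

/-- `a` is the globally defined bounded solution characterized by:
`X · s x₀` is bounded as `t → −∞` iff `x₀ ≤ a s`. -/
def CharA {h : ℝ → ℝ → ℝ} (F : MaxSolFamily h) (a : ℝ → ℝ) : Prop :=
  (∀ t, HasDerivAt a (h t (a t)) t) ∧ (∃ C, ∀ t, |a t| ≤ C) ∧
  ∀ s x₀ : ℝ, BddAtBot F s x₀ ↔ x₀ ≤ a s

/-- `r` is the globally defined bounded solution characterized by:
`X · s x₀` is bounded as `t → ∞` iff `x₀ ≥ r s`. -/
def CharR {h : ℝ → ℝ → ℝ} (F : MaxSolFamily h) (r : ℝ → ℝ) : Prop :=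
  (∀ t, HasDerivAt r (h t (r t)) t) ∧ (∃ C, ∀ t, |r t| ≤ C) ∧
  ∀ s x₀ : ℝ, BddAtTop F s x₀ ↔ r s ≤ x₀

/-- The difference of two ordered solutions satisfies `(a - r)' = (q - a - r) (a - r)`, in
integrated form. -/
theorem exp_integral_of_solutions_lt {q p a r : ℝ → ℝ} (hq : Continuous q)
    (ha : ∀ t, HasDerivAt a (quadF q p t (a t)) t) (hr : ∀ t, HasDerivAt r (quadF q p t (r t)) t)
    (hlt : ∀ t, r t < a t) (s t : ℝ) :
    Real.exp (∫ l in s..t, (q l - a l - r l)) = (a t - r t) / (a s - r s) := by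
  have hac : Continuous a := continuous_iff_continuousAt.2 fun x => (ha x).continuousAt
  have hrc : Continuous r := continuous_iff_continuousAt.2 fun x => (hr x).continuousAt
  have hpos : ∀ x, 0 < a x - r x := fun x => sub_pos.2 (hlt x)
  have hd : ∀ x, HasDerivAt (fun x => Real.log (a x - r x)) (q x - a x - r x) x := by
    intro x
    have h := ((ha x).fun_sub (hr x)).log (hpos x).ne'
    have e : (quadF q p x (a x) - quadF q p x (r x)) / (a x - r x) = q x - a x - r x := by
      rw [div_eq_iff (hpos x).ne']
      simp only [quadF]
      ring
    rwa [e] at h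
  rw [intervalIntegral.integral_eq_sub_of_hasDerivAt (fun x _ => hd x)
    (((hq.sub hac).sub hrc).intervalIntegrable s t), Real.exp_sub, Real.exp_log (hpos t),
    Real.exp_log (hpos s)]

/-- The integral of a continuous function bounded below by `δ` grows at least at rate `δ`. -/
theorem mul_sub_le_integral_of_le {u : ℝ → ℝ} (hu : Continuous u) {δ : ℝ} (hδ : ∀ t, δ ≤ u t)
    {s t : ℝ} (hst : s ≤ t) : δ * (t - s) ≤ ∫ l in s..t, u l := by
  have h := intervalIntegral.integral_mono_on (μ := MeasureTheory.volume) hst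
    intervalIntegrable_const (hu.intervalIntegrable s t) (fun x _ => hδ x)
  rw [intervalIntegral.integral_const, smul_eq_mul] at h
  linarith

theorem stmt8 (q p : ℝ → ℝ)
    (hqb : ∃ C, ∀ t, |q t| ≤ C) (hqu : UniformContinuous q)
    (hpb : ∃ C, ∀ t, |p t| ≤ C) (hpu : UniformContinuous p)
    (F : MaxSolFamily (quadF q p))
    (a r : ℝ → ℝ)
    (ha : CharA F a) (hr : CharR F r)
    (hsep : ∃ δ > (0:ℝ), ∀ t, δ ≤ a t - r t) :
    IsAttrHyp q p a ∧ IsRepHyp q p r := by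
  obtain ⟨had, ⟨A, hA⟩, -⟩ := ha
  obtain ⟨hrd, ⟨R, hR⟩, -⟩ := hr
  obtain ⟨δ, hδ, hsep⟩ := hsep
  have hac : Continuous a := continuous_iff_continuousAt.2 fun x => (had x).continuousAt
  have hrc : Continuous r := continuous_iff_continuousAt.2 fun x => (hrd x).continuousAt
  have huc : Continuous fun l => a l - r l := hac.sub hrc
  have hwc : Continuous fun l => q l - a l - r l := (hqu.continuous.sub hac).sub hrc
  have hle : ∀ t, a t - r t ≤ A + R := fun t => by
    linarith [(abs_le.1 (hA t)).2, (abs_le.1 (hR t)).1]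
  have hk : 1 ≤ (A + R) / δ := (one_le_div hδ).2 ((hsep 0).trans (hle 0))
  have hexp : ∀ s t, Real.exp (∫ l in s..t, (q l - a l - r l)) ≤ (A + R) / δ := fun s t => by
    rw [exp_integral_of_solutions_lt hqu.continuous had hrd fun x => by linarith [hsep x]]
    exact div_le_div₀ (by linarith [hsep t, hle t]) (hle t) hδ (hsep s)
  refine ⟨⟨⟨had, A, hA⟩, (A + R) / δ, δ, hk, hδ, fun s t hst => ?_⟩,
    ⟨⟨hrd, R, hR⟩, (A + R) / δ, δ, hk, hδ, fun s t hts => ?_⟩⟩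
  · have e : ∫ l in s..t, (-2 * a l + q l)
        = (∫ l in s..t, (q l - a l - r l)) - ∫ l in s..t, (a l - r l) := by
      rw [← intervalIntegral.integral_sub (hwc.intervalIntegrable s t)
        (huc.intervalIntegrable s t)]
      exact intervalIntegral.integral_congr fun l _ => by ring
    rw [e, sub_eq_add_neg, Real.exp_add]
    have h := mul_sub_le_integral_of_le huc hsep hst
    exact mul_le_mul (hexp s t) (Real.exp_le_exp.2 (by linarith)) (Real.exp_nonneg _)
      (by linarith)
  · have e : ∫ l in s..t, (-2 * r l + q l)
        = (∫ l in s..t, (q l - a l - r l)) + ∫ l in s..t, (a l - r l) := by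
      rw [← intervalIntegral.integral_add (hwc.intervalIntegrable s t)
        (huc.intervalIntegrable s t)]
      exact intervalIntegral.integral_congr fun l _ => by ring
    rw [e, Real.exp_add]
    have h := mul_sub_le_integral_of_le huc hsep hts
    rw [intervalIntegral.integral_symm] at h
    exact mul_le_mul (hexp s t) (Real.exp_le_exp.2 (by linarith)) (Real.exp_nonneg _)
      (by linarith)
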